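/- For every K > 0 there exists a constant C > 0 such that the following holds: for every level-2 α-Hölder rough path 𝐗 over V with ‖𝐗‖_α ≤ K, every F ∈ C_b^3(W, L(U,W)) with ‖F‖_{C_b^3} ≤ K, every 𝐗-controlled rough path 𝐙 = (Z,Z') with values in U with ‖Z'_0‖ ≤ K and ‖𝐙‖_{𝐗;α} ≤ K, and all 𝐗-controlled rough paths 𝐘 = (Y,Y') and 𝐘̃ = (Ỹ,Ỹ') with values in W satisfying ‖Y'_0‖, ‖Ỹ'_0‖, ‖𝐘‖_{𝐗;α}, ‖𝐘̃‖_{𝐗;α} ≤ K: ‖𝐉 − 𝐉̃‖_{𝐗;α} ≤ C ( T^α ‖𝐘 − 𝐘̃‖_{𝐗;α} + ‖Y_0 − Ỹ_0‖ + ‖Y'_0 − Ỹ'_0‖ ), where 𝐉 := (t ↦ Y_0 + ∫_0^t F(Y_r) dZ_r, t ↦ F(Y_t) ∘ Z'_t) and 𝐉̃ := (t ↦ Ỹ_0 + ∫_0^t F(Ỹ_r) dZ_r, t ↦ F(Ỹ_t) ∘ Z'_t). -/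

import Mathlib

/-!  Common definitions: level-2 rough paths, controlled rough paths,
compensated Riemann sums and rough integrals of a controlled rough path
against another controlled rough path. -/

open scoped BigOperators

noncomputable section

/-- `HBound T β A` : the two-parameter map `A` satisfies a `β`-Hölder bound on the
simplex `{0 ≤ s < t ≤ T}`. -/
def HBound {E : Type*} [NormedAddCommGroup E] (T β : ℝ) (A : ℝ → ℝ → E) : Prop :=
  ∃ C : ℝ, ∀ s t : ℝ, 0 ≤ s → s < t → t ≤ T → ‖A s t‖ ≤ C * (t - s) ^ β

/-- The Hölder seminorm `‖A‖_β = sup_{0 ≤ s < t ≤ T} ‖A_{s,t}‖ / (t-s)^β`, realised as the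
least admissible Hölder constant. -/
def hnorm {E : Type*} [NormedAddCommGroup E] (T β : ℝ) (A : ℝ → ℝ → E) : ℝ :=
  sInf {C : ℝ | 0 ≤ C ∧ ∀ s t : ℝ, 0 ≤ s → s < t → t ≤ T → ‖A s t‖ ≤ C * (t - s) ^ β}

/-- An abstract model of the projective tensor product `V ⊗̂ V`, bundling the canonical
bounded bilinear map `tmul : V × V → V ⊗̂ V` and the pairing `⋆` sending
`A ∈ L(V, L(W,U))` and `B ∈ L(V,W)` to the induced operator `A ⋆ B ∈ L(V ⊗̂ V, U)`,
characterised by `(A ⋆ B)(v₁ ⊗ v₂) = (A v₁)(B v₂)` and `‖A ⋆ B‖ ≤ ‖A‖ ‖B‖`. -/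
structure TensorOps (V V2 W U : Type*)
    [NormedAddCommGroup V] [NormedSpace ℝ V] [NormedAddCommGroup V2] [NormedSpace ℝ V2]
    [NormedAddCommGroup W] [NormedSpace ℝ W] [NormedAddCommGroup U] [NormedSpace ℝ U] where
  tmul : V →L[ℝ] V →L[ℝ] V2
  tmul_le : ∀ a b : V, ‖tmul a b‖ ≤ ‖a‖ * ‖b‖
  spair : (V →L[ℝ] (W →L[ℝ] U)) →L[ℝ] ((V →L[ℝ] W) →L[ℝ] (V2 →L[ℝ] U))
  spair_tmul : ∀ (A : V →L[ℝ] (W →L[ℝ] U)) (B : V →L[ℝ] W) (a b : V),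
    spair A B (tmul a b) = (A a) (B b)
  spair_le : ∀ (A : V →L[ℝ] (W →L[ℝ] U)) (B : V →L[ℝ] W), ‖spair A B‖ ≤ ‖A‖ * ‖B‖

section Defs

variable {V V2 E : Type*}
  [NormedAddCommGroup V] [NormedSpace ℝ V] [NormedAddCommGroup V2] [NormedSpace ℝ V2]
  [NormedAddCommGroup E] [NormedSpace ℝ E]

/-- `(X, XX)` is a level-2 `α`-Hölder rough path on `[0,T]`:
Chen's relation plus the analytic estimates. -/
structure IsRoughPath (T α : ℝ) (tmul : V →L[ℝ] V →L[ℝ] V2)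
    (X : ℝ → V) (XX : ℝ → ℝ → V2) : Prop where
  chen : ∀ s u t : ℝ, 0 ≤ s → s ≤ u → u ≤ t → t ≤ T →
    XX s t = XX s u + XX u t + tmul (X u - X s) (X t - X u)
  x_hold : HBound T α fun s t => X t - X s
  xx_hold : HBound T (2 * α) XX

/-- `‖𝐗‖_α := ‖X‖_α + ‖𝕏‖_{2α}`. -/
def rpNorm (T α : ℝ) (X : ℝ → V) (XX : ℝ → ℝ → V2) : ℝ :=
  hnorm T α (fun s t => X t - X s) + hnorm T (2 * α) XX

/-- `‖𝐗 − 𝐗̃‖_α := ‖X − X̃‖_α + ‖𝕏 − 𝕏̃‖_{2α}`. -/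
def rpDist (T α : ℝ) (X Xt : ℝ → V) (XX XXt : ℝ → ℝ → V2) : ℝ :=
  hnorm T α (fun s t => (X t - X s) - (Xt t - Xt s)) +
    hnorm T (2 * α) fun s t => XX s t - XXt s t

/-- The remainder `R^{𝐘}_{s,t} := Y_{s,t} − Y'_s(X_{s,t})` of a controlled rough path. -/
def Rem (X : ℝ → V) (Y : ℝ → E) (Y' : ℝ → V →L[ℝ] E) (s t : ℝ) : E :=
  Y t - Y s - Y' s (X t - X s)

/-- `(Y, Y')` is an `𝐗`-controlled rough path on `[0,T]` with values in `E`. -/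
structure IsCRP (T α : ℝ) (X : ℝ → V) (Y : ℝ → E) (Y' : ℝ → V →L[ℝ] E) : Prop where
  deriv_hold : HBound T α fun s t => Y' t - Y' s
  rem_hold : HBound T (2 * α) (Rem X Y Y')

/-- `‖𝐘‖_{𝐗;α} := ‖R^{𝐘}‖_{2α} + ‖Y'‖_α`. -/
def crpNorm (T α : ℝ) (X : ℝ → V) (Y : ℝ → E) (Y' : ℝ → V →L[ℝ] E) : ℝ :=
  hnorm T (2 * α) (Rem X Y Y') + hnorm T α fun s t => Y' t - Y' s

/-- `d_{𝐗,𝐗̃;α}(𝐘,𝐘̃) := ‖R^{𝐘} − R^{𝐘̃}‖_{2α} + ‖Y' − Ỹ'‖_α`. -/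
def crpDist (T α : ℝ) (X Xt : ℝ → V) (Y : ℝ → E) (Y' : ℝ → V →L[ℝ] E)
    (Yt : ℝ → E) (Yt' : ℝ → V →L[ℝ] E) : ℝ :=
  hnorm T (2 * α) (fun s t => Rem X Y Y' s t - Rem Xt Yt Yt' s t) +
    hnorm T α fun s t => (Y' t - Y' s) - (Yt' t - Yt' s)

/-- `p` is a finite partition `s = p 0 < p 1 < ⋯ < p n = t` of `[s,t]`. -/
def IsPartition (s t : ℝ) (n : ℕ) (p : ℕ → ℝ) : Prop :=
  p 0 = s ∧ p n = t ∧ ∀ i < n, p i < p (i + 1)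

end Defs

section Sums

variable {V V2 W U : Type*}
  [NormedAddCommGroup V] [NormedSpace ℝ V] [NormedAddCommGroup V2] [NormedSpace ℝ V2]
  [NormedAddCommGroup W] [NormedSpace ℝ W] [NormedAddCommGroup U] [NormedSpace ℝ U]

/-- The compensated Riemann sum
`∫_P Y dZ := Σ_i [ Y_{t_i}(Z_{t_i,t_{i+1}}) + (Y'_{t_i} ⋆ Z'_{t_i})(𝕏_{t_i,t_{i+1}}) ]`. -/
def rsum (tops : TensorOps V V2 W U) (XX : ℝ → ℝ → V2)
    (Y : ℝ → W →L[ℝ] U) (Y' : ℝ → V →L[ℝ] (W →L[ℝ] U))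
    (Z : ℝ → W) (Z' : ℝ → V →L[ℝ] W) (n : ℕ) (p : ℕ → ℝ) : U :=
  ∑ i ∈ Finset.range n,
    ((Y (p i)) (Z (p (i + 1)) - Z (p i)) +
      (tops.spair (Y' (p i)) (Z' (p i))) (XX (p i) (p (i + 1))))

/-- `I` is the rough integral `∫_s^t Y dZ`: the limit of the compensated Riemann sums
as the mesh of the partition tends to `0`. -/
def IsRoughIntegral (tops : TensorOps V V2 W U) (XX : ℝ → ℝ → V2)
    (Y : ℝ → W →L[ℝ] U) (Y' : ℝ → V →L[ℝ] (W →L[ℝ] U))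
    (Z : ℝ → W) (Z' : ℝ → V →L[ℝ] W) (s t : ℝ) (I : U) : Prop :=
  ∀ ε : ℝ, 0 < ε → ∃ δ : ℝ, 0 < δ ∧ ∀ (n : ℕ) (p : ℕ → ℝ), IsPartition s t n p →
    (∀ i < n, p (i + 1) - p i < δ) → ‖rsum tops XX Y Y' Z Z' n p - I‖ ≤ ε

end Sums

/-- The constant `C_α := (1 + T^α + T^{2α}) · 2^{3α} · Σ_{n≥1} n^{-3α}`. -/
def Calpha (T α : ℝ) : ℝ :=
  (1 + T ^ α + T ^ (2 * α)) * (2 : ℝ) ^ (3 * α) * ∑' n : ℕ, ((n : ℝ) + 1) ^ (-(3 * α))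

/-- `F ∈ C_b^k`: `k` times continuously Fréchet differentiable with all derivatives
up to order `k` bounded. -/
def IsCb {E₁ E₂ : Type*} [NormedAddCommGroup E₁] [NormedSpace ℝ E₁]
    [NormedAddCommGroup E₂] [NormedSpace ℝ E₂] (k : ℕ) (F : E₁ → E₂) : Prop :=
  ContDiff ℝ (k : ℕ∞) F ∧ ∀ j ≤ k, ∃ C : ℝ, ∀ x, ‖iteratedFDeriv ℝ j F x‖ ≤ C

/-- `‖F‖_{C_b^k} := Σ_{j=0}^k sup_x ‖D^j F(x)‖`. -/
def cbNorm {E₁ E₂ : Type*} [NormedAddCommGroup E₁] [NormedSpace ℝ E₁]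
    [NormedAddCommGroup E₂] [NormedSpace ℝ E₂] (k : ℕ) (F : E₁ → E₂) : ℝ :=
  ∑ j ∈ Finset.range (k + 1), ⨆ x : E₁, ‖iteratedFDeriv ℝ j F x‖

end

section

set_option maxSynthPendingDepth 3

section Hoelder

variable {E : Type*} [NormedAddCommGroup E]

theorem hnorm_nonneg (T β : ℝ) (A : ℝ → ℝ → E) : 0 ≤ hnorm T β A :=
  Real.sInf_nonneg fun _ h => h.1

theorem hnorm_le {T β C : ℝ} {A : ℝ → ℝ → E} (hC : 0 ≤ C)
    (h : ∀ s t : ℝ, 0 ≤ s → s < t → t ≤ T → ‖A s t‖ ≤ C * (t - s) ^ β) : hnorm T β A ≤ C :=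
  csInf_le ⟨0, fun _ h => h.1⟩ ⟨hC, h⟩

theorem HBound.norm_le {T β : ℝ} {A : ℝ → ℝ → E} (h : HBound T β A) {s t : ℝ}
    (hs : 0 ≤ s) (hst : s < t) (ht : t ≤ T) : ‖A s t‖ ≤ hnorm T β A * (t - s) ^ β := by
  have hpos : 0 < (t - s) ^ β := Real.rpow_pos_of_pos (sub_pos.2 hst) β
  rw [← div_le_iff₀ hpos]
  obtain ⟨C, hC⟩ := h
  refine le_csInf ⟨max C 0, le_max_right _ _, fun s t hs hst ht => (hC s t hs hst ht).trans ?_⟩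
    fun b hb => (div_le_iff₀ hpos).2 (hb.2 s t hs hst ht)
  have : 0 ≤ (t - s) ^ β := Real.rpow_nonneg (sub_pos.2 hst).le β
  gcongr
  exact le_max_left _ _

theorem HBound.sub {T β : ℝ} {A B : ℝ → ℝ → E} (hA : HBound T β A) (hB : HBound T β B) :
    HBound T β fun s t => A s t - B s t := by
  obtain ⟨C, hC⟩ := hA
  obtain ⟨D, hD⟩ := hB
  refine ⟨C + D, fun s t hs hst ht => (norm_sub_le _ _).trans ?_⟩
  rw [add_mul]
  exact add_le_add (hC s t hs hst ht) (hD s t hs hst ht)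

end Hoelder

section Calculus

variable {E F : Type*} [NormedAddCommGroup E] [NormedSpace ℝ E]
  [NormedAddCommGroup F] [NormedSpace ℝ F]

theorem norm_sub_le_of_fderiv_bound {g : E → F} {M : ℝ} (hg : Differentiable ℝ g)
    (h1 : ∀ x, ‖fderiv ℝ g x‖ ≤ M) (x y : E) : ‖g x - g y‖ ≤ M * ‖x - y‖ :=
  convex_univ.norm_image_sub_le_of_norm_fderiv_le (fun x _ => hg x) (fun x _ => h1 x)
    (Set.mem_univ y) (Set.mem_univ x)

theorem norm_taylor_le {g : E → F} {M : ℝ} (hg : Differentiable ℝ g)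
    (hg1 : Differentiable ℝ (fderiv ℝ g)) (h2 : ∀ x, ‖fderiv ℝ (fderiv ℝ g) x‖ ≤ M) (y v : E) :
    ‖g (y + v) - g y - fderiv ℝ g y v‖ ≤ M * ‖v‖ * ‖v‖ := by
  have hM : 0 ≤ M := (norm_nonneg _).trans (h2 0)
  have key := (convex_closedBall (0 : E) ‖v‖).norm_image_sub_le_of_norm_hasFDerivWithin_le
    (f := fun x => g (y + x) - fderiv ℝ g y x) (f' := fun x => fderiv ℝ g (y + x) - fderiv ℝ g y)
    (C := M * ‖v‖) (x := 0) (y := v)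
    (fun x _ => (((hasFDerivAt_comp_add_left y).2 (hg (y + x)).hasFDerivAt).sub
      (fderiv ℝ g y).hasFDerivAt).hasFDerivWithinAt)
    (fun x hx => by
      have := norm_sub_le_of_fderiv_bound hg1 h2 (y + x) y
      rw [add_sub_cancel_left] at this
      refine this.trans ?_
      gcongr
      simpa using hx)
    (by simp) (by simp)
  convert key using 2
  · simp; abel
  · simp

theorem norm_increment_sub_le {g : E → F} {L M : ℝ} (hg : Differentiable ℝ g)
    (hg1 : Differentiable ℝ (fderiv ℝ g)) (h1 : ∀ x, ‖fderiv ℝ g x‖ ≤ L)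
    (h2 : ∀ x, ‖fderiv ℝ (fderiv ℝ g) x‖ ≤ M) (y z v w : E) :
    ‖(g (y + v) - g y) - (g (z + w) - g z)‖ ≤ M * ‖v‖ * ‖y - z‖ + L * ‖v - w‖ := by
  have e1 := convex_univ.norm_image_sub_le_of_norm_hasFDerivWithin_le
    (f := fun x => g (x + v) - g x) (f' := fun x => fderiv ℝ g (x + v) - fderiv ℝ g x)
    (C := M * ‖v‖) (x := z) (y := y)
    (fun x _ => (((hasFDerivAt_comp_add_right v).2 (hg (x + v)).hasFDerivAt).sub
      (hg x).hasFDerivAt).hasFDerivWithinAt)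
    (fun x _ => by
      have := norm_sub_le_of_fderiv_bound hg1 h2 (x + v) x
      rwa [add_sub_cancel_left] at this)
    (Set.mem_univ _) (Set.mem_univ _)
  have e2 := norm_sub_le_of_fderiv_bound hg h1 (z + v) (z + w)
  rw [add_sub_add_left_eq_sub] at e2
  calc _ = ‖((g (y + v) - g y) - (g (z + v) - g z)) + (g (z + v) - g (z + w))‖ := by
        congr 1; abel
    _ ≤ _ := (norm_add_le _ _).trans (add_le_add e1 e2)

theorem norm_taylor_sub_le {g : E → F} {L M : ℝ} (hg : Differentiable ℝ g)
    (hg1 : Differentiable ℝ (fderiv ℝ g)) (hg2 : Differentiable ℝ (fderiv ℝ (fderiv ℝ g)))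
    (h2 : ∀ x, ‖fderiv ℝ (fderiv ℝ g) x‖ ≤ L)
    (h3 : ∀ x, ‖fderiv ℝ (fderiv ℝ (fderiv ℝ g)) x‖ ≤ M) {y z v w : E} {r : ℝ}
    (hv : ‖v‖ ≤ r) (hw : ‖w‖ ≤ r) :
    ‖(g (y + v) - g y - fderiv ℝ g y v) - (g (z + w) - g z - fderiv ℝ g z w)‖ ≤
      M * r * r * ‖y - z‖ + L * r * ‖v - w‖ := by
  have hL : 0 ≤ L := (norm_nonneg _).trans (h2 0)
  have hM : 0 ≤ M := (norm_nonneg _).trans (h3 0)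
  have hr : 0 ≤ r := (norm_nonneg v).trans hv
  have hMr : 0 ≤ M * r := mul_nonneg hM hr
  have e1 := convex_univ.norm_image_sub_le_of_norm_hasFDerivWithin_le
    (f := fun x => g (x + v) - g x - fderiv ℝ g x v)
    (f' := fun x => fderiv ℝ g (x + v) - fderiv ℝ g x - (fderiv ℝ (fderiv ℝ g) x).flip v)
    (C := M * r * r) (x := z) (y := y)
    (fun x _ => by
      refine ((((hasFDerivAt_comp_add_right v).2 (hg (x + v)).hasFDerivAt).sub
        (hg x).hasFDerivAt).sub ?_).hasFDerivWithinAt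
      have := (hg1 x).hasFDerivAt.clm_apply (hasFDerivAt_const v x)
      convert this using 1
      ext; simp)
    (fun x _ => by
      refine ContinuousLinearMap.opNorm_le_bound _ (by positivity) fun u => ?_
      have h := norm_taylor_le hg1 hg2 h3 x v
      have hsymm : (fderiv ℝ (fderiv ℝ g) x).flip v u = fderiv ℝ (fderiv ℝ g) x v u := by
        have := second_derivative_symmetric (f := g) (f' := fderiv ℝ g)
          (f'' := fderiv ℝ (fderiv ℝ g) x) (x := x)
          (fun y => (hg y).hasFDerivAt) (hg1 x).hasFDerivAt u v
        simpa using this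
      have := ContinuousLinearMap.le_of_opNorm_le _ h u
      simp only [sub_apply, hsymm] at this ⊢
      refine this.trans ?_
      gcongr)
    (Set.mem_univ _) (Set.mem_univ _)
  have e2 := (convex_closedBall (0 : E) r).norm_image_sub_le_of_norm_hasFDerivWithin_le
    (f := fun x => g (z + x) - g z - fderiv ℝ g z x)
    (f' := fun x => fderiv ℝ g (z + x) - fderiv ℝ g z)
    (C := L * r) (x := w) (y := v)
    (fun x _ => ((((hasFDerivAt_comp_add_left z).2 (hg (z + x)).hasFDerivAt).sub_const _).sub
      (fderiv ℝ g z).hasFDerivAt).hasFDerivWithinAt)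
    (fun x hx => by
      have := norm_sub_le_of_fderiv_bound hg1 h2 (z + x) z
      rw [add_sub_cancel_left] at this
      refine this.trans ?_
      gcongr
      simpa using hx)
    (by simpa using hw) (by simpa using hv)
  calc _ = ‖((g (y + v) - g y - fderiv ℝ g y v) - (g (z + v) - g z - fderiv ℝ g z v)) +
        ((g (z + v) - g z - fderiv ℝ g z v) - (g (z + w) - g z - fderiv ℝ g z w))‖ := by
        congr 1; abel
    _ ≤ _ := (norm_add_le _ _).trans (add_le_add e1 e2)

theorem IsCb.norm_iteratedFDeriv_le {k j : ℕ} {g : E → F} (hg : IsCb k g) (hj : j ≤ k) (x : E) :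
    ‖iteratedFDeriv ℝ j g x‖ ≤ cbNorm k g := by
  obtain ⟨C, hC⟩ := hg.2 j hj
  refine (le_ciSup (f := fun x => ‖iteratedFDeriv ℝ j g x‖) ⟨C, ?_⟩ x).trans ?_
  · rintro _ ⟨y, rfl⟩
    exact hC y
  · exact Finset.single_le_sum (f := fun j => ⨆ x : E, ‖iteratedFDeriv ℝ j g x‖)
      (fun i _ => Real.iSup_nonneg fun _ => norm_nonneg _)
      (Finset.mem_range.2 (Nat.lt_succ_of_le hj))

/-- `g` is three times differentiable, with derivatives of orders one to three bounded by `K`. -/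
structure ThreeDerivBound (K : ℝ) (g : E → F) : Prop where
  diff : Differentiable ℝ g
  diff_fderiv : Differentiable ℝ (fderiv ℝ g)
  diff_fderiv_fderiv : Differentiable ℝ (fderiv ℝ (fderiv ℝ g))
  bound_one : ∀ x, ‖fderiv ℝ g x‖ ≤ K
  bound_two : ∀ x, ‖fderiv ℝ (fderiv ℝ g) x‖ ≤ K
  bound_three : ∀ x, ‖fderiv ℝ (fderiv ℝ (fderiv ℝ g)) x‖ ≤ K

theorem IsCb.threeDerivBound {K : ℝ} {g : E → F} (hg : IsCb 3 g) (hK : cbNorm 3 g ≤ K) :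
    ThreeDerivBound K g := by
  have c0 : ContDiff ℝ 3 g := hg.1
  have c1 : ContDiff ℝ 2 (fderiv ℝ g) := c0.fderiv_right (by norm_num)
  have c2 : ContDiff ℝ 1 (fderiv ℝ (fderiv ℝ g)) := c1.fderiv_right (by norm_num)
  refine ⟨c0.differentiable (by norm_num), c1.differentiable (by norm_num),
    c2.differentiable (by norm_num), fun x => ?_, fun x => ?_, fun x => ?_⟩
  · rw [← norm_iteratedFDeriv_one]
    exact (hg.norm_iteratedFDeriv_le (by norm_num) x).trans hK
  · rw [← norm_iteratedFDeriv_one, norm_iteratedFDeriv_fderiv]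
    exact (hg.norm_iteratedFDeriv_le (by norm_num) x).trans hK
  · rw [← norm_iteratedFDeriv_one, norm_iteratedFDeriv_fderiv, norm_iteratedFDeriv_fderiv]
    exact (hg.norm_iteratedFDeriv_le (by norm_num) x).trans hK

end Calculus

section Sewing

theorem IsPartition.exists_concat {s u t : ℝ} {n m : ℕ} {p q : ℕ → ℝ}
    (hp : IsPartition s u n p) (hq : IsPartition u t m q) :
    ∃ r, IsPartition s t (n + m) r ∧ (∀ i ≤ n, r i = p i) ∧ ∀ j, r (n + j) = q j := by
  obtain ⟨p0, pn, pm⟩ := hp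
  obtain ⟨q0, qm, qmono⟩ := hq
  have hl : ∀ i ≤ n, (fun i => if i ≤ n then p i else q (i - n)) i = p i :=
    fun i hi => if_pos hi
  have hr : ∀ j, (fun i => if i ≤ n then p i else q (i - n)) (n + j) = q j := by
    intro j
    rcases j.eq_zero_or_pos with rfl | hj
    · simp [pn, q0]
    · simp [hj.ne']
  generalize (fun i => if i ≤ n then p i else q (i - n)) = r at hl hr
  refine ⟨r, ⟨?_, ?_, ?_⟩, hl, hr⟩
  · rw [hl 0 n.zero_le, p0]
  · rw [hr, qm]
  · intro i hi
    rcases lt_or_ge i n with h | h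
    · rw [hl i h.le, hl (i + 1) h]
      exact pm i h
    · obtain ⟨j, rfl⟩ := Nat.exists_eq_add_of_le h
      rw [hr j, add_assoc, hr (j + 1)]
      exact qmono j (by omega)

variable {E : Type*} [NormedAddCommGroup E]

theorem IsPartition.concat {s u t : ℝ} {n m : ℕ} {p q : ℕ → ℝ}
    (hp : IsPartition s u n p) (hq : IsPartition u t m q) :
    ∃ r, IsPartition s t (n + m) r ∧
      (∀ P : ℝ → ℝ → Prop, (∀ i < n, P (p i) (p (i + 1))) → (∀ i < m, P (q i) (q (i + 1))) →
        ∀ i < n + m, P (r i) (r (i + 1))) ∧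
      ∀ A : ℝ → ℝ → E, ∑ i ∈ Finset.range (n + m), A (r i) (r (i + 1)) =
        ∑ i ∈ Finset.range n, A (p i) (p (i + 1)) + ∑ i ∈ Finset.range m, A (q i) (q (i + 1)) := by
  obtain ⟨r, hr, hl, hrr⟩ := hp.exists_concat hq
  refine ⟨r, hr, fun P h1 h2 i hi => ?_, fun A => ?_⟩
  · rcases lt_or_ge i n with h | h
    · rw [hl i h.le, hl (i + 1) h]
      exact h1 i h
    · obtain ⟨j, rfl⟩ := Nat.exists_eq_add_of_le h
      rw [hrr j, add_assoc, hrr (j + 1)]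
      exact h2 j (by omega)
  · rw [Finset.sum_range_add]
    congr 1
    · refine Finset.sum_congr rfl fun i hi => ?_
      have := Finset.mem_range.1 hi
      rw [hl i this.le, hl (i + 1) this]
    · refine Finset.sum_congr rfl fun i _ => ?_
      rw [hrr i, add_assoc, hrr (i + 1)]

theorem exists_dyadic_sum_near {A : ℝ → ℝ → E} {M θ T : ℝ} (hθ : 1 < θ)
    (h : ∀ s u t, 0 ≤ s → s < u → u < t → t ≤ T →
      ‖A s u + A u t - A s t‖ ≤ M * (t - s) ^ θ) (k : ℕ) :
    ∀ s t, 0 ≤ s → s < t → t ≤ T → ∃ n p, IsPartition s t n p ∧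
      (∀ i < n, p (i + 1) - p i ≤ (t - s) / 2 ^ k) ∧
      ‖∑ i ∈ Finset.range n, A (p i) (p (i + 1)) - A s t‖ ≤
        M / (1 - 2 ^ (1 - θ)) * (t - s) ^ θ := by
  have h2 : (0 : ℝ) < 1 - 2 ^ (1 - θ) :=
    sub_pos.2 (Real.rpow_lt_one_of_one_lt_of_neg one_lt_two (by linarith))
  induction k with
  | zero =>
    intro s t hs hst ht
    have hM : 0 ≤ M * (t - s) ^ θ :=
      (norm_nonneg _).trans (h s ((s + t) / 2) t hs (by linarith) (by linarith) ht)
    refine ⟨1, fun i => if i = 0 then s else t, ⟨by simp, by simp, ?_⟩, by simp, ?_⟩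
    · intro i hi
      obtain rfl : i = 0 := by omega
      simpa using hst
    · simp only [Finset.sum_range_one]
      rw [div_mul_eq_mul_div]
      simpa using div_nonneg hM h2.le
  | succ k ih =>
    intro s t hs hst ht
    set u := (s + t) / 2 with hu
    have hsu : u - s = (t - s) / 2 := by rw [hu]; ring
    have hut : t - u = (t - s) / 2 := by rw [hu]; ring
    obtain ⟨n, p, hp, hpm, hpA⟩ := ih s u hs (by linarith) (by linarith)
    obtain ⟨m, q, hq, hqm, hqA⟩ := ih u t (by linarith) (by linarith) ht
    obtain ⟨r, hr, hrP, hrA⟩ := IsPartition.concat (E := E) hp hq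
    refine ⟨n + m, r, hr, ?_, ?_⟩
    · refine hrP (fun a b => b - a ≤ (t - s) / 2 ^ (k + 1)) ?_ ?_
      · intro i hi
        refine (hpm i hi).trans (le_of_eq ?_)
        rw [hsu, pow_succ]
        field_simp
      · intro i hi
        refine (hqm i hi).trans (le_of_eq ?_)
        rw [hut, pow_succ]
        field_simp
    · rw [hrA A]
      rw [hsu] at hpA
      rw [hut] at hqA
      have h0 := h s u t hs (by linarith) (by linarith) ht
      have hhalf : ((t - s) / 2) ^ θ = (t - s) ^ θ * 2 ^ (1 - θ) / 2 := by
        rw [Real.div_rpow (by linarith) (by norm_num), Real.rpow_sub (by norm_num), Real.rpow_one]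
        field_simp
      rw [hhalf] at hpA hqA
      set a := (t - s) ^ θ
      set b : ℝ := 2 ^ (1 - θ)
      calc _ = ‖(∑ i ∈ Finset.range n, A (p i) (p (i + 1)) - A s u) +
            (∑ i ∈ Finset.range m, A (q i) (q (i + 1)) - A u t) +
            (A s u + A u t - A s t)‖ := by congr 1; abel
        _ ≤ M / (1 - b) * (a * b / 2) + M / (1 - b) * (a * b / 2) + M * a :=
            norm_add₃_le.trans (add_le_add (add_le_add hpA hqA) h0)
        _ = M / (1 - b) * a := by
            field_simp
            ring

theorem exists_fine_sum_near {A : ℝ → ℝ → E} {M θ T δ : ℝ} (hθ : 1 < θ) (hδ : 0 < δ)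
    (h : ∀ s u t, 0 ≤ s → s < u → u < t → t ≤ T →
      ‖A s u + A u t - A s t‖ ≤ M * (t - s) ^ θ) {s t : ℝ} (hs : 0 ≤ s) (hst : s < t)
    (ht : t ≤ T) : ∃ n p, IsPartition s t n p ∧ (∀ i < n, p (i + 1) - p i < δ) ∧
      ‖∑ i ∈ Finset.range n, A (p i) (p (i + 1)) - A s t‖ ≤
        M / (1 - 2 ^ (1 - θ)) * (t - s) ^ θ := by
  obtain ⟨k, hk⟩ := pow_unbounded_of_one_lt ((t - s) / δ) (one_lt_two (α := ℝ))
  obtain ⟨n, p, hp, hm, hA⟩ := exists_dyadic_sum_near hθ h k s t hs hst ht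
  refine ⟨n, p, hp, fun i hi => (hm i hi).trans_lt ?_, hA⟩
  rw [div_lt_iff₀ (by positivity)]
  rw [div_lt_iff₀ hδ] at hk
  linarith

theorem exists_fine_partition {δ s t : ℝ} (hδ : 0 < δ) (hs : 0 ≤ s) (hst : s ≤ t) :
    ∃ n p, IsPartition s t n p ∧ ∀ i < n, p (i + 1) - p i < δ := by
  rcases hst.eq_or_lt with rfl | hst
  · exact ⟨0, fun _ => s, ⟨rfl, rfl, by simp⟩, by simp⟩
  · obtain ⟨n, p, hp, hm, -⟩ := exists_fine_sum_near (A := fun _ _ => (0 : ℝ)) (M := 0)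
      one_lt_two hδ (by simp) hs hst le_rfl
    exact ⟨n, p, hp, hm⟩

end Sewing

section Integral

variable {V V2 W U : Type*}
  [NormedAddCommGroup V] [NormedSpace ℝ V] [NormedAddCommGroup V2] [NormedSpace ℝ V2]
  [NormedAddCommGroup W] [NormedSpace ℝ W] [NormedAddCommGroup U] [NormedSpace ℝ U]
  {tops : TensorOps V V2 W U} {XX : ℝ → ℝ → V2}
  {Y Y₁ Y₂ : ℝ → W →L[ℝ] U} {Y' Y₁' Y₂' : ℝ → V →L[ℝ] (W →L[ℝ] U)}
  {Z : ℝ → W} {Z' : ℝ → V →L[ℝ] W}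

theorem IsRoughIntegral.sub_integrand {s t : ℝ} {I₁ I₂ : U}
    (h₁ : IsRoughIntegral tops XX Y₁ Y₁' Z Z' s t I₁)
    (h₂ : IsRoughIntegral tops XX Y₂ Y₂' Z Z' s t I₂) :
    IsRoughIntegral tops XX (fun r => Y₁ r - Y₂ r) (fun r => Y₁' r - Y₂' r) Z Z' s t
      (I₁ - I₂) := by
  intro ε hε
  obtain ⟨δ₁, hδ₁, H₁⟩ := h₁ (ε / 2) (half_pos hε)
  obtain ⟨δ₂, hδ₂, H₂⟩ := h₂ (ε / 2) (half_pos hε)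
  refine ⟨min δ₁ δ₂, lt_min hδ₁ hδ₂, fun n p hp hm => ?_⟩
  have e₁ := H₁ n p hp fun i hi => (hm i hi).trans_le (min_le_left _ _)
  have e₂ := H₂ n p hp fun i hi => (hm i hi).trans_le (min_le_right _ _)
  have : rsum tops XX (fun r => Y₁ r - Y₂ r) (fun r => Y₁' r - Y₂' r) Z Z' n p =
      rsum tops XX Y₁ Y₁' Z Z' n p - rsum tops XX Y₂ Y₂' Z Z' n p := by
    simp only [rsum, ← Finset.sum_sub_distrib]
    refine Finset.sum_congr rfl fun i _ => ?_
    simp only [map_sub, sub_apply]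
    abel
  rw [this, sub_sub_sub_comm]
  linarith [norm_sub_le (rsum tops XX Y₁ Y₁' Z Z' n p - I₁) (rsum tops XX Y₂ Y₂' Z Z' n p - I₂)]

theorem IsRoughIntegral.sub_initial {s t : ℝ} (hs : 0 ≤ s) {I₁ I₂ : U}
    (h₁ : IsRoughIntegral tops XX Y Y' Z Z' 0 s I₁)
    (h₂ : IsRoughIntegral tops XX Y Y' Z Z' 0 t I₂) :
    IsRoughIntegral tops XX Y Y' Z Z' s t (I₂ - I₁) := by
  intro ε hε
  obtain ⟨δ₁, hδ₁, H₁⟩ := h₁ (ε / 2) (half_pos hε)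
  obtain ⟨δ₂, hδ₂, H₂⟩ := h₂ (ε / 2) (half_pos hε)
  refine ⟨δ₂, hδ₂, fun m q hq hm => ?_⟩
  obtain ⟨n, p, hp, hpm⟩ := exists_fine_partition (lt_min hδ₁ hδ₂) le_rfl hs
  obtain ⟨r, hr, hrP, hrA⟩ := IsPartition.concat (E := U) hp hq
  have e₁ := H₁ n p hp fun i hi => (hpm i hi).trans_le (min_le_left _ _)
  have e₂ := H₂ _ r hr (hrP (fun a b => b - a < δ₂)
    (fun i hi => (hpm i hi).trans_le (min_le_right _ _)) hm)
  have : rsum tops XX Y Y' Z Z' (n + m) r =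
      rsum tops XX Y Y' Z Z' n p + rsum tops XX Y Y' Z Z' m q :=
    hrA fun a b => Y a (Z b - Z a) + tops.spair (Y' a) (Z' a) (XX a b)
  rw [this] at e₂
  calc _ = ‖(rsum tops XX Y Y' Z Z' n p + rsum tops XX Y Y' Z Z' m q - I₂) -
        (rsum tops XX Y Y' Z Z' n p - I₁)‖ := by congr 1; abel
    _ ≤ _ := (norm_sub_le _ _).trans (by linarith)

theorem IsRoughIntegral.norm_sub_germ_le {M θ T s t : ℝ} {I : U} (hθ : 1 < θ)
    (hI : IsRoughIntegral tops XX Y Y' Z Z' s t I)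
    (h : ∀ s u t, 0 ≤ s → s < u → u < t → t ≤ T →
      ‖(Y s (Z u - Z s) + tops.spair (Y' s) (Z' s) (XX s u)) +
        (Y u (Z t - Z u) + tops.spair (Y' u) (Z' u) (XX u t)) -
        (Y s (Z t - Z s) + tops.spair (Y' s) (Z' s) (XX s t))‖ ≤ M * (t - s) ^ θ)
    (hs : 0 ≤ s) (hst : s < t) (ht : t ≤ T) :
    ‖I - (Y s (Z t - Z s) + tops.spair (Y' s) (Z' s) (XX s t))‖ ≤
      M / (1 - 2 ^ (1 - θ)) * (t - s) ^ θ := by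
  refine le_of_forall_pos_le_add fun ε hε => ?_
  obtain ⟨δ, hδ, H⟩ := hI ε hε
  obtain ⟨n, p, hp, hm, hA⟩ := exists_fine_sum_near
    (A := fun a b => Y a (Z b - Z a) + tops.spair (Y' a) (Z' a) (XX a b)) hθ hδ h hs hst ht
  have e := H n p hp hm
  refine (norm_sub_le_norm_sub_add_norm_sub I (rsum tops XX Y Y' Z Z' n p) _).trans ?_
  rw [norm_sub_rev I, add_comm]
  exact add_le_add hA e

end Integral

section Controlled

variable {V V2 W U E : Type*}
  [NormedAddCommGroup V] [NormedSpace ℝ V] [NormedAddCommGroup V2] [NormedSpace ℝ V2]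
  [NormedAddCommGroup W] [NormedSpace ℝ W] [NormedAddCommGroup U] [NormedSpace ℝ U]
  [NormedAddCommGroup E] [NormedSpace ℝ E]

theorem norm_apply_le_mul {f : W →L[ℝ] U} {x : W} {a b : ℝ} (hf : ‖f‖ ≤ a) (hx : ‖x‖ ≤ b) :
    ‖f x‖ ≤ a * b :=
  (f.le_of_opNorm_le hf x).trans (mul_le_mul_of_nonneg_left hx ((norm_nonneg f).trans hf))

theorem norm_comp_le_mul {f : W →L[ℝ] U} {g : V →L[ℝ] W} {a b : ℝ} (hf : ‖f‖ ≤ a)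
    (hg : ‖g‖ ≤ b) : ‖f.comp g‖ ≤ a * b :=
  (f.opNorm_comp_le g).trans
    (mul_le_mul hf hg (norm_nonneg g) ((norm_nonneg f).trans hf))

theorem TensorOps.norm_spair_apply_le (tops : TensorOps V V2 W U) {A : V →L[ℝ] (W →L[ℝ] U)}
    {B : V →L[ℝ] W} {x : V2} {a b c : ℝ} (hA : ‖A‖ ≤ a) (hB : ‖B‖ ≤ b) (hx : ‖x‖ ≤ c) :
    ‖tops.spair A B x‖ ≤ a * b * c :=
  norm_apply_le_mul ((tops.spair_le A B).trans
    (mul_le_mul hA hB (norm_nonneg B) ((norm_nonneg A).trans hA))) hx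

theorem Rem_sub (X : ℝ → V) (Y Yt : ℝ → E) (Y' Yt' : ℝ → V →L[ℝ] E) (s t : ℝ) :
    Rem X (fun r => Y r - Yt r) (fun r => Y' r - Yt' r) s t =
      Rem X Y Y' s t - Rem X Yt Yt' s t := by
  simp only [Rem, sub_apply]
  abel

/-- All the data of a controlled path, apart from the size of the path itself, are bounded
by `m`. -/
structure CtrlBound (T α m : ℝ) (X : ℝ → V) (Y : ℝ → E) (Y' : ℝ → V →L[ℝ] E) : Prop where
  deriv : ∀ s, 0 ≤ s → s ≤ T → ‖Y' s‖ ≤ m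
  deriv_inc : ∀ s t, 0 ≤ s → s < t → t ≤ T → ‖Y' t - Y' s‖ ≤ m * (t - s) ^ α
  inc : ∀ s t, 0 ≤ s → s < t → t ≤ T → ‖Y t - Y s‖ ≤ m * (t - s) ^ α
  rem : ∀ s t, 0 ≤ s → s < t → t ≤ T → ‖Rem X Y Y' s t‖ ≤ m * ((t - s) ^ α) ^ 2

variable {T α : ℝ} {X : ℝ → V}

theorem CtrlBound.mono {m m' : ℝ} {Y : ℝ → E} {Y' : ℝ → V →L[ℝ] E}
    (h : CtrlBound T α m X Y Y') (hm : m ≤ m') : CtrlBound T α m' X Y Y' where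
  deriv s hs ht := (h.deriv s hs ht).trans hm
  deriv_inc s t hs hst ht := (h.deriv_inc s t hs hst ht).trans
    (mul_le_mul_of_nonneg_right hm (Real.rpow_nonneg (sub_pos.2 hst).le α))
  inc s t hs hst ht := (h.inc s t hs hst ht).trans
    (mul_le_mul_of_nonneg_right hm (Real.rpow_nonneg (sub_pos.2 hst).le α))
  rem s t hs hst ht := (h.rem s t hs hst ht).trans
    (mul_le_mul_of_nonneg_right hm (sq_nonneg _))

theorem rpow_two_mul_eq_sq {h : ℝ} (hh : 0 ≤ h) (α : ℝ) : h ^ (2 * α) = (h ^ α) ^ 2 := by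
  rw [mul_comm, Real.rpow_mul hh, Real.rpow_two]

theorem rpow_sub_le_rpow {s t T : ℝ} (hα : 0 ≤ α) (hs : 0 ≤ s) (hst : s < t) (ht : t ≤ T) :
    (t - s) ^ α ≤ T ^ α :=
  Real.rpow_le_rpow (sub_pos.2 hst).le (by linarith) hα

theorem ctrlBound_of_initial {N K : ℝ} {Y : ℝ → E} {Y' : ℝ → V →L[ℝ] E} (hα : 0 ≤ α)
    (hT : 0 ≤ T) (hK : 0 ≤ K)
    (hX : ∀ s t, 0 ≤ s → s < t → t ≤ T → ‖X t - X s‖ ≤ K * (t - s) ^ α)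
    (h0 : ‖Y' 0‖ ≤ N)
    (hd : ∀ s t, 0 ≤ s → s < t → t ≤ T → ‖Y' t - Y' s‖ ≤ N * (t - s) ^ α)
    (hr : ∀ s t, 0 ≤ s → s < t → t ≤ T → ‖Rem X Y Y' s t‖ ≤ N * (t - s) ^ (2 * α)) :
    CtrlBound T α (N * ((1 + T ^ α) * (1 + K))) X Y Y' := by
  have hN : 0 ≤ N := (norm_nonneg _).trans h0
  have hB : 0 ≤ T ^ α := Real.rpow_nonneg hT α
  have hle : ∀ x, x ≤ (1 + T ^ α) * (1 + K) → N * x ≤ N * ((1 + T ^ α) * (1 + K)) :=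
    fun x hx => mul_le_mul_of_nonneg_left hx hN
  have h1 : N ≤ N * ((1 + T ^ α) * (1 + K)) := by
    have := hle 1 (by nlinarith)
    rwa [mul_one] at this
  have hderiv : ∀ s, 0 ≤ s → s ≤ T → ‖Y' s‖ ≤ N * (1 + T ^ α) := by
    intro s hs hsT
    rcases hs.eq_or_lt with rfl | hs'
    · nlinarith
    · have e1 := hd 0 s le_rfl hs' hsT
      have e2 := mul_le_mul_of_nonneg_left (rpow_sub_le_rpow hα le_rfl hs' hsT) hN
      linarith [norm_le_norm_add_norm_sub' (Y' s) (Y' 0)]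
  refine ⟨fun s hs hsT => (hderiv s hs hsT).trans (hle _ (by nlinarith)),
    fun s t hs hst ht => (hd s t hs hst ht).trans ?_, fun s t hs hst ht => ?_,
    fun s t hs hst ht => ?_⟩
  · exact mul_le_mul_of_nonneg_right h1 (Real.rpow_nonneg (sub_pos.2 hst).le α)
  · have ha : 0 ≤ (t - s) ^ α := Real.rpow_nonneg (sub_pos.2 hst).le α
    have haB := rpow_sub_le_rpow hα hs hst ht
    have e1 := hr s t hs hst ht
    rw [rpow_two_mul_eq_sq (sub_pos.2 hst).le] at e1
    have e2 := norm_apply_le_mul (hderiv s hs (hst.le.trans ht)) (hX s t hs hst ht)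
    have e3 : Y t - Y s = Rem X Y Y' s t + Y' s (X t - X s) := by simp [Rem]
    rw [e3]
    refine (norm_add_le _ _).trans ((add_le_add e1 e2).trans ?_)
    have e4 : N * ((t - s) ^ α) ^ 2 ≤ N * (T ^ α * (t - s) ^ α) := by
      rw [sq]
      gcongr
    have e5 : 0 ≤ N * (t - s) ^ α := mul_nonneg hN ha
    nlinarith
  · have := hr s t hs hst ht
    rw [rpow_two_mul_eq_sq (sub_pos.2 hst).le] at this
    exact this.trans (mul_le_mul_of_nonneg_right h1 (sq_nonneg _))

theorem IsCRP.ctrlBound {K : ℝ} {Y : ℝ → E} {Y' : ℝ → V →L[ℝ] E} (hY : IsCRP T α X Y Y')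
    (hα : 0 ≤ α) (hT : 0 ≤ T) (hK : 0 ≤ K)
    (hX : ∀ s t, 0 ≤ s → s < t → t ≤ T → ‖X t - X s‖ ≤ K * (t - s) ^ α)
    (h0 : ‖Y' 0‖ ≤ K) (hYK : crpNorm T α X Y Y' ≤ K) :
    CtrlBound T α (K * ((1 + T ^ α) * (1 + K))) X Y Y' :=
  ctrlBound_of_initial hα hT hK hX h0
    (fun _ _ hs hst ht => (hY.deriv_hold.norm_le hs hst ht).trans
      (mul_le_mul_of_nonneg_right
        (le_trans (le_add_of_nonneg_left (hnorm_nonneg _ _ _)) hYK)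
        (Real.rpow_nonneg (sub_pos.2 hst).le _)))
    (fun _ _ hs hst ht => (hY.rem_hold.norm_le hs hst ht).trans
      (mul_le_mul_of_nonneg_right
        (le_trans (le_add_of_nonneg_right (hnorm_nonneg _ _ _)) hYK)
        (Real.rpow_nonneg (sub_pos.2 hst).le _)))

theorem CtrlBound.comp_sub {c m K : ℝ} {F : W → E} (hF : ThreeDerivBound K F)
    {Y Yt : ℝ → W} {Y' Yt' : ℝ → V →L[ℝ] W}
    (hY : CtrlBound T α c X Y Y') (hYt : CtrlBound T α c X Yt Yt')
    (hΔ : CtrlBound T α m X (fun r => Y r - Yt r) (fun r => Y' r - Yt' r))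
    (h0 : ∀ s, 0 ≤ s → s ≤ T → ‖Y s - Yt s‖ ≤ m) (hT : 0 ≤ T) :
    (∀ s, 0 ≤ s → s ≤ T → ‖F (Y s) - F (Yt s)‖ ≤ K * m) ∧
    CtrlBound T α (K * m * (c ^ 2 + 3 * c + 1)) X (fun r => F (Y r) - F (Yt r))
      (fun r => (fderiv ℝ F (Y r)).comp (Y' r) - (fderiv ℝ F (Yt r)).comp (Yt' r)) := by
  have hK : 0 ≤ K := (norm_nonneg _).trans (hF.bound_one 0)
  have hc : 0 ≤ c := (norm_nonneg _).trans (hY.deriv 0 le_rfl hT)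
  have hm : 0 ≤ m := (norm_nonneg _).trans (h0 0 le_rfl hT)
  have hKm : 0 ≤ K * m := mul_nonneg hK hm
  have hKmc : 0 ≤ K * m * c := mul_nonneg hKm hc
  have hKmcc : 0 ≤ K * m * c ^ 2 := mul_nonneg hKm (sq_nonneg c)
  have hval : ∀ s, 0 ≤ s → s ≤ T → ‖F (Y s) - F (Yt s)‖ ≤ K * m := fun s hs hsT =>
    (norm_sub_le_of_fderiv_bound hF.diff hF.bound_one _ _).trans
      (mul_le_mul_of_nonneg_left (h0 s hs hsT) hK)
  have hval' : ∀ s, 0 ≤ s → s ≤ T → ‖fderiv ℝ F (Y s) - fderiv ℝ F (Yt s)‖ ≤ K * m :=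
    fun s hs hsT => (norm_sub_le_of_fderiv_bound hF.diff_fderiv hF.bound_two _ _).trans
      (mul_le_mul_of_nonneg_left (h0 s hs hsT) hK)
  have hincΔ : ∀ s t, 0 ≤ s → s < t → t ≤ T →
      ‖(Y t - Y s) - (Yt t - Yt s)‖ ≤ m * (t - s) ^ α := fun s t hs hst ht => by
    have := hΔ.inc s t hs hst ht
    rwa [sub_sub_sub_comm]
  refine ⟨hval, fun s hs hsT => ?_, fun s t hs hst ht => ?_, fun s t hs hst ht => ?_,
    fun s t hs hst ht => ?_⟩
  · have e1 := norm_comp_le_mul (hval' s hs hsT) (hY.deriv s hs hsT)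
    have e2 := norm_comp_le_mul (hF.bound_one (Yt s)) (hΔ.deriv s hs hsT)
    calc _ = ‖(fderiv ℝ F (Y s) - fderiv ℝ F (Yt s)).comp (Y' s) +
          (fderiv ℝ F (Yt s)).comp (Y' s - Yt' s)‖ := by
          congr 1; ext v; simp
      _ ≤ _ := (norm_add_le _ _).trans (by nlinarith)
  · have ha : 0 ≤ (t - s) ^ α := Real.rpow_nonneg (sub_pos.2 hst).le α
    have hs' := hst.le.trans ht
    have ht' := hs.trans hst.le
    have i1 := norm_increment_sub_le hF.diff_fderiv hF.diff_fderiv_fderiv hF.bound_two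
      hF.bound_three (Y s) (Yt s) (Y t - Y s) (Yt t - Yt s)
    rw [add_sub_cancel, add_sub_cancel] at i1
    have i2 : ‖(fderiv ℝ F (Y t) - fderiv ℝ F (Y s)) -
        (fderiv ℝ F (Yt t) - fderiv ℝ F (Yt s))‖ ≤
        K * (c * (t - s) ^ α) * m + K * (m * (t - s) ^ α) := by
      refine i1.trans (add_le_add ?_ (mul_le_mul_of_nonneg_left (hincΔ s t hs hst ht) hK))
      exact mul_le_mul (mul_le_mul_of_nonneg_left (hY.inc s t hs hst ht) hK)
        (h0 s hs hs') (norm_nonneg _) (by positivity)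
    have i3 : ‖fderiv ℝ F (Yt t) - fderiv ℝ F (Yt s)‖ ≤ K * (c * (t - s) ^ α) :=
      (norm_sub_le_of_fderiv_bound hF.diff_fderiv hF.bound_two _ _).trans
        (mul_le_mul_of_nonneg_left (hYt.inc s t hs hst ht) hK)
    have e1 := norm_comp_le_mul i2 (hY.deriv t ht' ht)
    have e2 := norm_comp_le_mul (hval' s hs hs') (hY.deriv_inc s t hs hst ht)
    have e3 := norm_comp_le_mul i3 (hΔ.deriv t ht' ht)
    have e4 := norm_comp_le_mul (hF.bound_one (Yt s)) (hΔ.deriv_inc s t hs hst ht)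
    refine (le_of_eq ?_).trans (((norm_add₄_le).trans
      (add_le_add (add_le_add (add_le_add e1 e2) e3) e4)).trans (le_of_eq (by ring)))
    congr 1
    ext v
    simp only [sub_apply, add_apply, ContinuousLinearMap.comp_apply, map_sub]
    abel
  · have ha : 0 ≤ (t - s) ^ α := Real.rpow_nonneg (sub_pos.2 hst).le α
    have i1 := norm_increment_sub_le hF.diff hF.diff_fderiv hF.bound_one
      hF.bound_two (Y s) (Yt s) (Y t - Y s) (Yt t - Yt s)
    rw [add_sub_cancel, add_sub_cancel] at i1
    have i2 : K * ‖Y t - Y s‖ * ‖Y s - Yt s‖ ≤ K * (c * (t - s) ^ α) * m :=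
      mul_le_mul (mul_le_mul_of_nonneg_left (hY.inc s t hs hst ht) hK)
        (h0 s hs (hst.le.trans ht)) (norm_nonneg _) (by positivity)
    have i3 := mul_le_mul_of_nonneg_left (hincΔ s t hs hst ht) hK
    rw [sub_sub_sub_comm]
    refine i1.trans ((add_le_add i2 i3).trans ?_)
    have := mul_nonneg hKmc ha
    have := mul_nonneg hKmcc ha
    nlinarith
  · have ha : 0 ≤ (t - s) ^ α := Real.rpow_nonneg (sub_pos.2 hst).le α
    have hs' := hst.le.trans ht
    have i1 := norm_taylor_sub_le hF.diff hF.diff_fderiv hF.diff_fderiv_fderiv hF.bound_two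
      hF.bound_three (y := Y s) (z := Yt s) (hY.inc s t hs hst ht) (hYt.inc s t hs hst ht)
    rw [add_sub_cancel, add_sub_cancel] at i1
    have i2 := i1.trans (add_le_add
      (mul_le_mul_of_nonneg_left (h0 s hs hs') (by positivity))
      (mul_le_mul_of_nonneg_left (hincΔ s t hs hst ht) (by positivity)))
    have e1 := norm_apply_le_mul (hval' s hs hs') (hY.rem s t hs hst ht)
    have e2 := norm_apply_le_mul (hF.bound_one (Yt s)) (hΔ.rem s t hs hst ht)
    refine (le_of_eq ?_).trans ((norm_add₃_le.trans
      (add_le_add (add_le_add i2 e1) e2)).trans ?_)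
    · rw [Rem_sub]
      congr 1
      simp only [Rem, sub_apply, ContinuousLinearMap.comp_apply, map_sub]
      abel
    · have := mul_nonneg hKmc (sq_nonneg ((t - s) ^ α))
      nlinarith

theorem CtrlBound.germ_defect_le {c m K : ℝ} {tops : TensorOps V V2 W U} {XX : ℝ → ℝ → V2}
    {D : ℝ → W →L[ℝ] U} {D' : ℝ → V →L[ℝ] (W →L[ℝ] U)} {Z : ℝ → W} {Z' : ℝ → V →L[ℝ] W}
    (hα : 0 ≤ α)
    (hX : IsRoughPath T α tops.tmul X XX)
    (hXK : ∀ s t, 0 ≤ s → s < t → t ≤ T → ‖X t - X s‖ ≤ K * (t - s) ^ α)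
    (hXXK : ∀ s t, 0 ≤ s → s < t → t ≤ T → ‖XX s t‖ ≤ K * ((t - s) ^ α) ^ 2)
    (hD : CtrlBound T α m X D D') (hZ : CtrlBound T α c X Z Z') (hK : 0 ≤ K)
    {s u t : ℝ} (hs : 0 ≤ s) (hsu : s < u) (hut : u < t) (ht : t ≤ T) :
    ‖(D s (Z u - Z s) + tops.spair (D' s) (Z' s) (XX s u)) +
        (D u (Z t - Z u) + tops.spair (D' u) (Z' u) (XX u t)) -
        (D s (Z t - Z s) + tops.spair (D' s) (Z' s) (XX s t))‖ ≤
      m * c * (1 + 3 * K + K ^ 2) * (t - s) ^ (3 * α) := by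
  have hu : 0 ≤ u := hs.trans hsu.le
  have huT : u ≤ T := hut.le.trans ht
  have hsT : s ≤ T := hsu.le.trans huT
  have hc : 0 ≤ c := (norm_nonneg _).trans (hZ.deriv s hs hsT)
  have hm : 0 ≤ m := (norm_nonneg _).trans (hD.deriv s hs hsT)
  have hp : (0 : ℝ) ≤ (u - s) ^ α := Real.rpow_nonneg (sub_pos.2 hsu).le α
  have hq : (0 : ℝ) ≤ (t - u) ^ α := Real.rpow_nonneg (sub_pos.2 hut).le α
  have hpa : (u - s) ^ α ≤ (t - s) ^ α :=
    Real.rpow_le_rpow (sub_pos.2 hsu).le (by linarith) hα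
  have hqa : (t - u) ^ α ≤ (t - s) ^ α :=
    Real.rpow_le_rpow (sub_pos.2 hut).le (by linarith) hα
  have h3 : (t - s) ^ (3 * α) = ((t - s) ^ α) ^ 3 := by
    rw [mul_comm, Real.rpow_mul (by linarith)]
    exact_mod_cast Real.rpow_natCast _ 3
  rw [h3]
  set a := (t - s) ^ α
  have b1 : ‖D' s (X u - X s)‖ ≤ m * (K * a) :=
    norm_apply_le_mul (hD.deriv s hs hsT) ((hXK s u hs hsu huT).trans (by gcongr))
  have b2 : ‖(Z' u - Z' s) (X t - X u)‖ ≤ (c * a) * (K * a) :=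
    norm_apply_le_mul ((hZ.deriv_inc s u hs hsu huT).trans (by gcongr))
      ((hXK u t hu hut ht).trans (by gcongr))
  have b3 : ‖Rem X Z Z' u t‖ ≤ c * a ^ 2 := (hZ.rem u t hu hut ht).trans (by gcongr)
  have b4 : ‖Rem X D D' s u‖ ≤ m * a ^ 2 := (hD.rem s u hs hsu huT).trans (by gcongr)
  have b5 : ‖Z t - Z u‖ ≤ c * a := (hZ.inc u t hu hut ht).trans (by gcongr)
  have b6 : ‖XX u t‖ ≤ K * a ^ 2 := (hXXK u t hu hut ht).trans (by gcongr)
  have e1 := norm_apply_le_mul b4 b5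
  have e2 := norm_apply_le_mul b1 ((norm_add_le _ _).trans (add_le_add b3 b2))
  have e3 := tops.norm_spair_apply_le
    ((hD.deriv_inc s u hs hsu huT).trans (mul_le_mul_of_nonneg_left hpa hm))
    (hZ.deriv s hs hsT) b6
  have e4 := tops.norm_spair_apply_le (hD.deriv u hu huT)
    ((hZ.deriv_inc s u hs hsu huT).trans (mul_le_mul_of_nonneg_left hpa hc)) b6
  refine (le_of_eq ?_).trans ((norm_add₄_le.trans
    (add_le_add (add_le_add (add_le_add e1 e2) e3) e4)).trans (le_of_eq (by ring)))
  · rw [hX.chen s u t hs hsu.le hut.le ht]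
    congr 1
    simp only [map_add, tops.spair_tmul, Rem, sub_apply, map_sub]
    abel

theorem CtrlBound.integral_sub {c m K : ℝ} {tops : TensorOps V V2 W U} {XX : ℝ → ℝ → V2}
    {D : ℝ → W →L[ℝ] U} {D' : ℝ → V →L[ℝ] (W →L[ℝ] U)} {Z : ℝ → W} {Z' : ℝ → V →L[ℝ] W}
    {J : ℝ → U} (hα : 1 / 3 < α)
    (hX : IsRoughPath T α tops.tmul X XX)
    (hXK : ∀ s t, 0 ≤ s → s < t → t ≤ T → ‖X t - X s‖ ≤ K * (t - s) ^ α)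
    (hXXK : ∀ s t, 0 ≤ s → s < t → t ≤ T → ‖XX s t‖ ≤ K * ((t - s) ^ α) ^ 2)
    (hD : CtrlBound T α m X D D') (hD0 : ∀ s, 0 ≤ s → s ≤ T → ‖D s‖ ≤ m)
    (hZ : CtrlBound T α c X Z Z') (hK : 0 ≤ K)
    (hJ : ∀ t, 0 ≤ t → t ≤ T → IsRoughIntegral tops XX D D' Z Z' 0 t (J t))
    {s t : ℝ} (hs : 0 ≤ s) (hst : s < t) (ht : t ≤ T) :
    ‖Rem X J (fun r => (D r).comp (Z' r)) s t‖ ≤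
        m * c * ((1 + 3 * K + K ^ 2) / (1 - 2 ^ (1 - 3 * α)) * T ^ α + 1 + K) *
          (t - s) ^ (2 * α) ∧
      ‖(D t).comp (Z' t) - (D s).comp (Z' s)‖ ≤ m * c * 2 * (t - s) ^ α := by
  have hα0 : 0 ≤ α := by linarith
  have hsT : s ≤ T := hst.le.trans ht
  have htT : 0 ≤ t := hs.trans hst.le
  have hc : 0 ≤ c := (norm_nonneg _).trans (hZ.deriv s hs hsT)
  have hm : 0 ≤ m := (norm_nonneg _).trans (hD.deriv s hs hsT)
  have ha : (0 : ℝ) ≤ (t - s) ^ α := Real.rpow_nonneg (sub_pos.2 hst).le α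
  have haT : (t - s) ^ α ≤ T ^ α := rpow_sub_le_rpow hα0 hs hst ht
  have hden : (0 : ℝ) < 1 - 2 ^ (1 - 3 * α) :=
    sub_pos.2 (Real.rpow_lt_one_of_one_lt_of_neg one_lt_two (by linarith))
  constructor
  · have e1 := ((hJ s hs hsT).sub_initial hs (hJ t htT ht)).norm_sub_germ_le
      (T := T) (θ := 3 * α) (by linarith)
      (fun s u t hs hsu hut ht => hD.germ_defect_le hα0 hX hXK hXXK hZ hK hs hsu hut ht)
      hs hst ht
    have e2 := norm_apply_le_mul (hD0 s hs hsT) (hZ.rem s t hs hst ht)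
    have e3 := tops.norm_spair_apply_le (hD.deriv s hs hsT) (hZ.deriv s hs hsT)
      (hXXK s t hs hst ht)
    have h3 : (t - s) ^ (3 * α) = ((t - s) ^ α) ^ 2 * (t - s) ^ α := by
      rw [← rpow_two_mul_eq_sq (sub_pos.2 hst).le, ← Real.rpow_add (sub_pos.2 hst)]
      congr 1
      ring
    rw [h3] at e1
    rw [rpow_two_mul_eq_sq (sub_pos.2 hst).le]
    have e4 := e1.trans (mul_le_mul_of_nonneg_left
      (mul_le_mul_of_nonneg_left haT (sq_nonneg _)) (by positivity))
    refine (le_of_eq ?_).trans ((norm_add₃_le.trans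
      (add_le_add (add_le_add e4 e2) e3)).trans (le_of_eq (by ring)))
    congr 1
    simp only [Rem, map_sub, ContinuousLinearMap.comp_apply]
    abel
  · have e1 := norm_comp_le_mul (hD.inc s t hs hst ht) (hZ.deriv t htT ht)
    have e2 := norm_comp_le_mul (hD0 s hs hsT) (hZ.deriv_inc s t hs hst ht)
    refine (le_of_eq ?_).trans ((norm_add_le _ _).trans
      ((add_le_add e1 e2).trans (le_of_eq (by ring))))
    congr 1
    ext v
    simp

end Controlled

end

/-- stability of `𝐉` with respect to the controlled path `𝐘`. -/
theorem stmt12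
    {V V2 W U : Type*} [NormedAddCommGroup V] [NormedSpace ℝ V] [CompleteSpace V]
    [NormedAddCommGroup V2] [NormedSpace ℝ V2] [CompleteSpace V2]
    [NormedAddCommGroup W] [NormedSpace ℝ W] [CompleteSpace W]
    [NormedAddCommGroup U] [NormedSpace ℝ U] [CompleteSpace U]
    (T α : ℝ) (hT : 0 < T) (hα : 1 / 3 < α) (hα' : α ≤ 1 / 2)
    (tops : TensorOps V V2 U W) :
    ∀ K : ℝ, 0 < K → ∃ C : ℝ, 0 < C ∧
      ∀ (X : ℝ → V) (XX : ℝ → ℝ → V2), IsRoughPath T α tops.tmul X XX →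
        rpNorm T α X XX ≤ K →
      ∀ F : W → U →L[ℝ] W, IsCb 3 F → cbNorm 3 F ≤ K →
      ∀ (Z : ℝ → U) (Z' : ℝ → V →L[ℝ] U), IsCRP T α X Z Z' →
        ‖Z' 0‖ ≤ K → crpNorm T α X Z Z' ≤ K →
      ∀ (Y Yt : ℝ → W) (Y' Yt' : ℝ → V →L[ℝ] W),
        IsCRP T α X Y Y' → IsCRP T α X Yt Yt' →
        ‖Y' 0‖ ≤ K → ‖Yt' 0‖ ≤ K →
        crpNorm T α X Y Y' ≤ K → crpNorm T α X Yt Yt' ≤ K →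
      ∀ J Jt : ℝ → W,
        (∀ t : ℝ, 0 ≤ t → t ≤ T →
          IsRoughIntegral tops XX (fun r => F (Y r))
            (fun r => (fderiv ℝ F (Y r)).comp (Y' r)) Z Z' 0 t (J t)) →
        (∀ t : ℝ, 0 ≤ t → t ≤ T →
          IsRoughIntegral tops XX (fun r => F (Yt r))
            (fun r => (fderiv ℝ F (Yt r)).comp (Yt' r)) Z Z' 0 t (Jt t)) →
        crpDist T α X X (fun t => Y 0 + J t) (fun t => (F (Y t)).comp (Z' t))
            (fun t => Yt 0 + Jt t) (fun t => (F (Yt t)).comp (Z' t)) ≤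
          C * (T ^ α * crpDist T α X X Y Y' Yt Yt' +
            ‖Y 0 - Yt 0‖ + ‖Y' 0 - Yt' 0‖) := by
  intro K hK
  have hα0 : 0 ≤ α := by linarith
  have hB : 0 < T ^ α := Real.rpow_pos_of_pos hT α
  have hden : (0 : ℝ) < 1 - 2 ^ (1 - 3 * α) :=
    sub_pos.2 (Real.rpow_lt_one_of_one_lt_of_neg one_lt_two (by linarith))
  set κ := (1 + T ^ α) * (1 + K) with hκ
  have hκ0 : 0 < κ := by positivity
  set c := K * κ with hc
  have hc0 : 0 < c := by positivity
  set μ := κ + 1 + κ * T ^ α with hμ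
  have hμ0 : 0 < μ := by positivity
  set ν := K * μ * (c ^ 2 + 3 * c + 1) with hν
  have hν0 : 0 < ν := by positivity
  set L := (1 + 3 * K + K ^ 2) / (1 - 2 ^ (1 - 3 * α)) * T ^ α + 1 + K with hL
  have hL0 : 0 < L := by positivity
  refine ⟨ν * c * (L + 2) * (1 + 1 / T ^ α), by positivity, ?_⟩
  intro X XX hX hXK F hF hFK Z Z' hZ hZ0 hZK Y Yt Y' Yt' hY hYt hY0 hYt0 hYK hYtK J Jt hJ hJt
  have weaken : ∀ {a b r : ℝ} {s t : ℝ}, a ≤ b → s < t → r ≤ a * (t - s) ^ α →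
      r ≤ b * (t - s) ^ α := fun hab hst h =>
    h.trans (mul_le_mul_of_nonneg_right hab (Real.rpow_nonneg (sub_pos.2 hst).le _))
  have weaken2 : ∀ {a b r : ℝ} {s t : ℝ}, a ≤ b → s < t → r ≤ a * (t - s) ^ (2 * α) →
      r ≤ b * (t - s) ^ (2 * α) := fun hab hst h =>
    h.trans (mul_le_mul_of_nonneg_right hab (Real.rpow_nonneg (sub_pos.2 hst).le _))
  have hX1 : ∀ s t, 0 ≤ s → s < t → t ≤ T → ‖X t - X s‖ ≤ K * (t - s) ^ α :=
    fun s t hs hst ht => weaken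
      (le_trans (le_add_of_nonneg_right (hnorm_nonneg _ _ _)) hXK) hst
      (hX.x_hold.norm_le hs hst ht)
  have hX2 : ∀ s t, 0 ≤ s → s < t → t ≤ T → ‖XX s t‖ ≤ K * ((t - s) ^ α) ^ 2 :=
    fun s t hs hst ht => by
      rw [← rpow_two_mul_eq_sq (sub_pos.2 hst).le]
      exact weaken2 (le_trans (le_add_of_nonneg_left (hnorm_nonneg _ _ _)) hXK) hst
        (hX.xx_hold.norm_le hs hst ht)
  have bZ : CtrlBound T α c X Z Z' := hZ.ctrlBound hα0 hT.le hK.le hX1 hZ0 hZK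
  have bY : CtrlBound T α c X Y Y' := hY.ctrlBound hα0 hT.le hK.le hX1 hY0 hYK
  have bYt : CtrlBound T α c X Yt Yt' := hYt.ctrlBound hα0 hT.le hK.le hX1 hYt0 hYtK
  set d := crpDist T α X X Y Y' Yt Yt' with hd
  have hd0 : 0 ≤ d := add_nonneg (hnorm_nonneg _ _ _) (hnorm_nonneg _ _ _)
  set N := d + ‖Y 0 - Yt 0‖ + ‖Y' 0 - Yt' 0‖ with hN
  have hN0 : 0 ≤ N := by positivity
  have hdN : d ≤ N := by
    rw [hN, add_assoc]
    exact le_add_of_nonneg_right (by positivity)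
  have hyN : ‖Y 0 - Yt 0‖ ≤ N := by
    linarith [norm_nonneg (Y' 0 - Yt' 0)]
  have bΔ : CtrlBound T α (N * κ) X (fun r => Y r - Yt r) (fun r => Y' r - Yt' r) := by
    refine ctrlBound_of_initial hα0 hT.le hK.le hX1 ?_ ?_ ?_
    · exact le_add_of_nonneg_left (by positivity)
    · intro s t hs hst ht
      rw [sub_sub_sub_comm]
      exact weaken (le_trans (le_add_of_nonneg_left (hnorm_nonneg _ _ _)) hdN) hst
        ((hY.deriv_hold.sub hYt.deriv_hold).norm_le hs hst ht)
    · intro s t hs hst ht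
      rw [Rem_sub]
      exact weaken2 (le_trans (le_add_of_nonneg_right (hnorm_nonneg _ _ _)) hdN) hst
        ((hY.rem_hold.sub hYt.rem_hold).norm_le hs hst ht)
  have hΔ0 : ∀ s, 0 ≤ s → s ≤ T → ‖Y s - Yt s‖ ≤ N * μ := by
    intro s hs hsT
    have hx : N * μ = N * κ + N + N * κ * T ^ α := by rw [hμ]; ring
    have h1 : 0 ≤ N * κ := by positivity
    have h2 : 0 ≤ N * κ * T ^ α := by positivity
    rcases hs.eq_or_lt with rfl | hs'
    · linarith
    · have e1 := bΔ.inc 0 s le_rfl hs' hsT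
      have e2 := mul_le_mul_of_nonneg_left (rpow_sub_le_rpow hα0 le_rfl hs' hsT) h1
      linarith [norm_le_norm_add_norm_sub' (Y s - Yt s) (Y 0 - Yt 0)]
  have hκμ : N * κ ≤ N * μ := by
    have : 0 ≤ κ * T ^ α := by positivity
    exact mul_le_mul_of_nonneg_left (by linarith) hN0
  obtain ⟨hD0, bD⟩ := CtrlBound.comp_sub (hF.threeDerivBound hFK) bY bYt (bΔ.mono hκμ) hΔ0 hT.le
  have hm : K * (N * μ) * (c ^ 2 + 3 * c + 1) = N * ν := by rw [hν]; ring
  rw [hm] at bD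
  have hD0' : ∀ s, 0 ≤ s → s ≤ T → ‖F (Y s) - F (Yt s)‖ ≤ N * ν := fun s hs hsT => by
    refine (hD0 s hs hsT).trans ?_
    rw [← hm]
    exact le_mul_of_one_le_right (by positivity) (by nlinarith)
  have key := fun {s t : ℝ} (hs : 0 ≤ s) (hst : s < t) (ht : t ≤ T) =>
    bD.integral_sub hα hX hX1 hX2 hD0' bZ hK.le (J := fun t => J t - Jt t)
      (fun t ht htT => (hJ t ht htT).sub_integrand (hJt t ht htT)) hs hst ht
  have hrem : hnorm T (2 * α) (fun s t =>
      Rem X (fun t => Y 0 + J t) (fun t => (F (Y t)).comp (Z' t)) s t -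
      Rem X (fun t => Yt 0 + Jt t) (fun t => (F (Yt t)).comp (Z' t)) s t) ≤ N * ν * c * L := by
    refine hnorm_le (by positivity) fun s t hs hst ht => ?_
    refine (le_of_eq ?_).trans (key hs hst ht).1
    congr 1
    simp only [Rem, sub_apply, ContinuousLinearMap.comp_apply]
    abel
  have hder : hnorm T α (fun s t => ((F (Y t)).comp (Z' t) - (F (Y s)).comp (Z' s)) -
      ((F (Yt t)).comp (Z' t) - (F (Yt s)).comp (Z' s))) ≤ N * ν * c * 2 := by
    refine hnorm_le (by positivity) fun s t hs hst ht => ?_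
    refine (le_of_eq ?_).trans (key hs hst ht).2
    congr 1
    rw [sub_sub_sub_comm, ContinuousLinearMap.sub_comp, ContinuousLinearMap.sub_comp]
  have hNle : N ≤ (1 + 1 / T ^ α) * (T ^ α * d + ‖Y 0 - Yt 0‖ + ‖Y' 0 - Yt' 0‖) := by
    have h1 : (1 + 1 / T ^ α) * (T ^ α * d + ‖Y 0 - Yt 0‖ + ‖Y' 0 - Yt' 0‖) =
        N + (T ^ α * d + (1 / T ^ α) * (‖Y 0 - Yt 0‖ + ‖Y' 0 - Yt' 0‖)) := by
      rw [hN]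
      field_simp
      ring
    rw [h1]
    exact le_add_of_nonneg_right (by positivity)
  calc _ ≤ N * ν * c * L + N * ν * c * 2 := add_le_add hrem hder
    _ = ν * c * (L + 2) * N := by ring
    _ ≤ ν * c * (L + 2) *
        ((1 + 1 / T ^ α) * (T ^ α * d + ‖Y 0 - Yt 0‖ + ‖Y' 0 - Yt' 0‖)) :=
        mul_le_mul_of_nonneg_left hNle (by positivity)
    _ = _ := by ring
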